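/- Let k be a positive integer. If α > 1 and β > 1 satisfy a(α) = b(β) − 2kπ and |I(α)| = |F(β)|, then I(α) = F(β), and the function u : [0,d] → ℝ defined by u(t) = u_α(t) for t ∈ [0,t₀] and u(t) = u*_β(t) for t ∈ [t₀,d] belongs to C¹([0,d]) ∩ C²((0,d)), satisfies equation (★) on (0,d), satisfies u'(0) = u'(d) = 0, and has exactly 2k zeros in the open interval (0,d). -/

import Mathlib

open Set Filter

/-- `u` is a solution of the ODE `u'' + h u' + λ(|u|^{q-1} u - u) = 0`,
being C¹ on the closed set `S` (with derivative `u'`) and C² on `Sint`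
(with second derivative `u''`), where the equation holds on `Sint`. -/
def SolOn (h : ℝ → ℝ) (lam q : ℝ) (S Sint : Set ℝ) (u u' u'' : ℝ → ℝ) : Prop :=
  (∀ t ∈ S, HasDerivWithinAt u (u' t) S t) ∧
  ContinuousOn u' S ∧
  (∀ t ∈ Sint, HasDerivWithinAt u' (u'' t) Sint t) ∧
  ContinuousOn u'' Sint ∧
  (∀ t ∈ Sint, u'' t + h t * u' t + lam * (|u t| ^ (q - 1) * u t - u t) = 0)

/-- The Euclidean norm on ℝ². -/
noncomputable def enorm2 (p : ℝ × ℝ) : ℝ := Real.sqrt (p.1 ^ 2 + p.2 ^ 2)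

theorem hasDerivAt_abs_rpow_mul_self {q : ℝ} (hq : 1 < q) (x : ℝ) :
    HasDerivAt (fun y : ℝ => |y| ^ (q - 1) * y) (q * |x| ^ (q - 1)) x := by
  rcases eq_or_ne x 0 with rfl | hx
  · have h0 : (0 : ℝ) ^ (q - 1) = 0 := Real.zero_rpow (by linarith)
    have hc : Tendsto (fun y : ℝ => |y| ^ (q - 1)) (nhds 0) (nhds 0) := by
      have : Continuous fun y : ℝ => |y| ^ (q - 1) :=
        continuous_abs.rpow_const fun _ => Or.inr (by linarith)
      simpa [h0] using this.tendsto 0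
    rw [hasDerivAt_iff_isLittleO]
    simp only [abs_zero, h0, mul_zero, sub_zero, smul_eq_mul]
    have := ((Asymptotics.isLittleO_one_iff ℝ).2 hc).mul_isBigO
      (Asymptotics.isBigO_refl (fun y : ℝ => y) (nhds 0))
    simpa using this
  · have hx' : |x| ≠ 0 := abs_ne_zero.2 hx
    have h1 := ((hasDerivAt_abs hx).rpow_const (p := q - 1) (Or.inl hx')).mul (hasDerivAt_id x)
    refine h1.congr_deriv ?_
    have hs : (SignType.sign x : ℝ) * x = |x| := by
      exact sign_mul_self x
    have hp : |x| ^ (q - 1) = |x| ^ (q - 1 - 1) * |x| := by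
      rw [← Real.rpow_add_one hx']; congr 1; ring
    simp only [id, mul_one]
    calc _ = (q - 1) * |x| ^ (q - 1 - 1) * (↑(SignType.sign x) * x) + |x| ^ (q - 1) := by ring
      _ = _ := by rw [hs, mul_assoc, ← hp]; ring

theorem abs_rpow_mul_self_lipschitz {q : ℝ} (hq : 1 < q) {M x y : ℝ}
    (hx : |x| ≤ M) (hy : |y| ≤ M) :
    |(|x| ^ (q - 1) * x) - |y| ^ (q - 1) * y| ≤ q * M ^ (q - 1) * |x - y| := by
  have := (convex_Icc (-M) M).norm_image_sub_le_of_norm_hasDerivWithin_le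
    (f := fun y : ℝ => |y| ^ (q - 1) * y) (f' := fun x => q * |x| ^ (q - 1))
    (C := q * M ^ (q - 1)) (x := y) (y := x)
    (fun z _ => (hasDerivAt_abs_rpow_mul_self hq z).hasDerivWithinAt)
    (fun z hz => by
      have h0 : 0 ≤ |z| ^ (q - 1) := Real.rpow_nonneg (abs_nonneg _) _
      rw [Real.norm_of_nonneg (by positivity)]
      have : |z| ^ (q - 1) ≤ M ^ (q - 1) :=
        Real.rpow_le_rpow (abs_nonneg _) (abs_le.2 hz) (by linarith)
      nlinarith)
    (abs_le.1 hy) (abs_le.1 hx)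
  simpa only [Real.norm_eq_abs] using this

theorem exists_abs_le_of_potential_le {q : ℝ} (hq : 1 < q) (K : ℝ) :
    ∃ M, 0 ≤ M ∧ ∀ x : ℝ, |x| ^ (q + 1) / (q + 1) - x ^ 2 / 2 ≤ K → |x| ≤ M := by
  set N := (q + 1) ^ (1 / (q - 1)) with hN
  have hN0 : 0 ≤ N := Real.rpow_nonneg (by linarith) _
  have hNq : N ^ (q - 1) = q + 1 := by
    rw [hN, ← Real.rpow_mul (by linarith), one_div_mul_cancel (by linarith), Real.rpow_one]
  refine ⟨N + 2 * |K| + 1, by positivity, fun x hx => ?_⟩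
  by_contra! hc
  have hK : 0 ≤ |K| := abs_nonneg _
  have h1 : q + 1 ≤ |x| ^ (q - 1) := by
    rw [← hNq]; exact Real.rpow_le_rpow hN0 (by linarith) (by linarith)
  have h2 : |x| ^ (q + 1) = |x| ^ (q - 1) * x ^ 2 := by
    rw [← sq_abs x, ← Real.rpow_natCast |x| 2, ← Real.rpow_add (by linarith)]
    congr 1; push_cast; ring
  have h3 : x ^ 2 ≤ |x| ^ (q + 1) / (q + 1) := by
    rw [le_div_iff₀ (by linarith), h2]; nlinarith [sq_nonneg x]
  have h4 : 2 * |K| < x ^ 2 := by rw [← sq_abs]; nlinarith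
  linarith [le_abs_self K]

section HalfInterval

variable {h : ℝ → ℝ} {lam q T : ℝ} {u u' u'' v v' v'' : ℝ → ℝ}

theorem SolOn.hasDerivAt (hu : SolOn h lam q (Icc 0 T) (Ioc 0 T) u u' u'') {t : ℝ}
    (ht : t ∈ Ioo 0 T) : HasDerivAt u (u' t) t ∧ HasDerivAt u' (u'' t) t :=
  ⟨(hu.1 t (Ioo_subset_Icc_self ht)).hasDerivAt (Icc_mem_nhds ht.1 ht.2),
    (hu.2.2.1 t (Ioo_subset_Ioc_self ht)).hasDerivAt (Ioc_mem_nhds ht.1 ht.2)⟩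

theorem SolOn.continuousOn (hu : SolOn h lam q (Icc 0 T) (Ioc 0 T) u u' u'') :
    ContinuousOn u (Icc 0 T) := fun t ht => (hu.1 t ht).continuousWithinAt

/-- The energy `u'² / 2 + λ (|u|^{q+1} / (q+1) - u² / 2)` does not increase where `h ≥ 0`. -/
theorem SolOn.potential_le (hq : 1 < q) (hlam : 0 < lam) (hh : ∀ t ∈ Ioo 0 T, 0 ≤ h t)
    (hu : SolOn h lam q (Icc 0 T) (Ioc 0 T) u u' u'') (hu0 : u' 0 = 0) {t : ℝ}
    (ht : t ∈ Icc 0 T) :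
    |u t| ^ (q + 1) / (q + 1) - u t ^ 2 / 2 ≤ |u 0| ^ (q + 1) / (q + 1) - u 0 ^ 2 / 2 := by
  let E : ℝ → ℝ := fun t =>
    u' t ^ 2 / 2 + lam * (|u t| ^ (q + 1) / (q + 1) - u t ^ 2 / 2)
  have hd : ∀ t ∈ Ioo 0 T, HasDerivAt E (-h t * u' t ^ 2) t := by
    intro t ht
    obtain ⟨h1, h2⟩ := hu.hasDerivAt ht
    have h3 := (hasDerivAt_abs_rpow (u t) (p := q + 1) (by linarith)).comp t h1
    have h4 := ((h2.pow 2).div_const 2).add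
      (((h3.div_const (q + 1)).sub ((h1.pow 2).div_const 2)).const_mul lam)
    refine h4.congr_deriv ?_
    have ho := hu.2.2.2.2 t (Ioo_subset_Ioc_self ht)
    have hq' : q + 1 - 2 = q - 1 := by ring
    have hq0 : q + 1 ≠ 0 := by linarith
    rw [hq']
    field_simp
    push_cast
    linear_combination 2 * u' t * ho
  have hc : ContinuousOn E (Icc 0 T) := by
    have := hu.continuousOn
    have := hu.2.1
    have : ContinuousOn (fun t => |u t| ^ (q + 1)) (Icc 0 T) :=
      hu.continuousOn.abs.rpow_const fun _ _ => Or.inr (by linarith)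
    fun_prop
  have ha : AntitoneOn E (Icc 0 T) := by
    refine antitoneOn_of_hasDerivWithinAt_nonpos (f' := fun t => -h t * u' t ^ 2)
      (convex_Icc 0 T) hc ?_ ?_
    · rw [interior_Icc]; exact fun t ht => (hd t ht).hasDerivWithinAt
    · rw [interior_Icc]; intro t ht
      have := mul_nonneg (hh t ht) (sq_nonneg (u' t))
      linarith
  have := ha ⟨le_rfl, ht.1.trans ht.2⟩ ht ht.1
  simp only [E, hu0] at this
  have h5 : 0 ≤ u' t ^ 2 := sq_nonneg _
  refine le_of_mul_le_mul_left ?_ hlam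
  linarith

/-- The derivative of the squared phase-space distance of two solutions. -/
theorem SolOn.hasDerivAt_dist (hu : SolOn h lam q (Icc 0 T) (Ioc 0 T) u u' u'')
    (hv : SolOn h lam q (Icc 0 T) (Ioc 0 T) v v' v'') {t : ℝ} (ht : t ∈ Ioo 0 T) :
    HasDerivAt (fun t => (u t - v t) ^ 2 + (u' t - v' t) ^ 2)
      (2 * (u t - v t) * (u' t - v' t) * (1 + lam) - 2 * h t * (u' t - v' t) ^ 2
        - 2 * lam * (u' t - v' t) * (|u t| ^ (q - 1) * u t - |v t| ^ (q - 1) * v t)) t := by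
  obtain ⟨h1, h2⟩ := hu.hasDerivAt ht
  obtain ⟨h3, h4⟩ := hv.hasDerivAt ht
  refine (((h1.sub h3).pow 2).add ((h2.sub h4).pow 2)).congr_deriv ?_
  have o1 := hu.2.2.2.2 t (Ioo_subset_Ioc_self ht)
  have o2 := hv.2.2.2.2 t (Ioo_subset_Ioc_self ht)
  simp only [Pi.sub_apply]
  push_cast
  linear_combination 2 * (u' t - v' t) * (o1 - o2)

theorem SolOn.continuousOn_dist (hu : SolOn h lam q (Icc 0 T) (Ioc 0 T) u u' u'')
    (hv : SolOn h lam q (Icc 0 T) (Ioc 0 T) v v' v'') :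
    ContinuousOn (fun t => (u t - v t) ^ 2 + (u' t - v' t) ^ 2) (Icc 0 T) := by
  have := hu.continuousOn
  have := hu.2.1
  have := hv.continuousOn
  have := hv.2.1
  fun_prop

theorem abs_two_mul_mul_le {w w' f L lam : ℝ} (hlam : 0 < lam) (hL : 0 ≤ L)
    (hf : |f| ≤ L * |w|) :
    |2 * w * w' * (1 + lam) - 2 * lam * w' * f| ≤ (1 + lam + lam * L) * (w ^ 2 + w' ^ 2) := by
  have e : |2 * w * w'| ≤ w ^ 2 + w' ^ 2 := by
    rw [abs_le]; constructor <;> nlinarith [sq_nonneg (w - w'), sq_nonneg (w + w')]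
  have e' : 2 * |w| * |w'| ≤ w ^ 2 + w' ^ 2 := by
    simpa [abs_mul] using e
  have k1 : |2 * lam * w' * f| ≤ lam * L * (w ^ 2 + w' ^ 2) := by
    have : |2 * lam * w' * f| = 2 * lam * |w'| * |f| := by
      simp [abs_mul, abs_of_pos hlam]
    rw [this]
    calc 2 * lam * |w'| * |f| ≤ 2 * lam * |w'| * (L * |w|) := by gcongr
      _ = lam * L * (2 * |w| * |w'|) := by ring
      _ ≤ _ := by gcongr
  have k2 : |2 * w * w' * (1 + lam)| ≤ (1 + lam) * (w ^ 2 + w' ^ 2) := by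
    rw [abs_mul, abs_of_pos (by linarith : 0 < 1 + lam), mul_comm]
    exact mul_le_mul_of_nonneg_left e (by linarith)
  have k3 := abs_sub (2 * w * w' * (1 + lam)) (2 * lam * w' * f)
  linarith

theorem le_mul_exp_of_hasDerivAt_le {D D' : ℝ → ℝ} {C a b : ℝ} (hab : a ≤ b)
    (hc : ContinuousOn D (Icc a b)) (hd : ∀ t ∈ Ioo a b, HasDerivAt D (D' t) t)
    (hD : ∀ t ∈ Ioo a b, D' t ≤ C * D t) : D b ≤ D a * Real.exp (C * (b - a)) := by
  have ha : AntitoneOn (fun t => D t * Real.exp (-(C * (t - a)))) (Icc a b) := by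
    refine antitoneOn_of_hasDerivWithinAt_nonpos
      (f' := fun t => (D' t - C * D t) * Real.exp (-(C * (t - a)))) (convex_Icc a b)
      (by fun_prop) ?_ ?_
    · rw [interior_Icc]
      intro t ht
      have hE : HasDerivAt (fun t => Real.exp (-(C * (t - a))))
          (Real.exp (-(C * (t - a))) * -(C * 1)) t :=
        (((hasDerivAt_id t).sub_const a).const_mul C).neg.exp
      exact (((hd t ht).mul hE).congr_deriv (by ring)).hasDerivWithinAt
    · rw [interior_Icc]
      intro t ht
      exact mul_nonpos_of_nonpos_of_nonneg (by linarith [hD t ht]) (Real.exp_pos _).le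
  have := ha ⟨le_rfl, hab⟩ ⟨hab, le_rfl⟩ hab
  simp only [sub_self, mul_zero, neg_zero, Real.exp_zero, mul_one] at this
  rwa [Real.exp_neg, ← div_eq_mul_inv, div_le_iff₀ (Real.exp_pos _)] at this

theorem le_mul_exp_of_le_hasDerivAt {D D' : ℝ → ℝ} {C a b : ℝ} (hab : a ≤ b)
    (hc : ContinuousOn D (Icc a b)) (hd : ∀ t ∈ Ioo a b, HasDerivAt D (D' t) t)
    (hD : ∀ t ∈ Ioo a b, -(C * D t) ≤ D' t) : D a ≤ D b * Real.exp (C * (b - a)) := by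
  have := le_mul_exp_of_hasDerivAt_le (D := fun t => D (-t)) (D' := fun t => -D' (-t)) (C := C)
    (neg_le_neg hab) (hc.comp continuousOn_neg fun t ht => ⟨by linarith [ht.2], by linarith [ht.1]⟩)
    (fun t ht => ((hd (-t) ⟨by linarith [ht.2], by linarith [ht.1]⟩).comp t
      (hasDerivAt_neg t)).congr_deriv (mul_neg_one _))
    (fun t ht => by linarith [hD (-t) ⟨by linarith [ht.2], by linarith [ht.1]⟩])
  simp only [neg_neg] at this
  rwa [show -a - -b = b - a by ring] at this

/-- Where `h ≥ 0`, the phase-space distance of two bounded solutions grows at most exponentially. -/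
theorem SolOn.dist_le (hq : 1 < q) (hlam : 0 < lam) (hh : ∀ t ∈ Ioo 0 T, 0 ≤ h t)
    (hu : SolOn h lam q (Icc 0 T) (Ioc 0 T) u u' u'')
    (hv : SolOn h lam q (Icc 0 T) (Ioc 0 T) v v' v'') {M : ℝ}
    (huM : ∀ t ∈ Icc 0 T, |u t| ≤ M) (hvM : ∀ t ∈ Icc 0 T, |v t| ≤ M) {t : ℝ}
    (ht : t ∈ Icc 0 T) :
    (u t - v t) ^ 2 + (u' t - v' t) ^ 2 ≤
      ((u 0 - v 0) ^ 2 + (u' 0 - v' 0) ^ 2) *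
        Real.exp ((1 + lam + lam * (q * M ^ (q - 1))) * t) := by
  have hM : 0 ≤ M := (abs_nonneg _).trans (huM t ht)
  have hL : 0 ≤ q * M ^ (q - 1) := mul_nonneg (by linarith) (Real.rpow_nonneg hM _)
  have key := le_mul_exp_of_hasDerivAt_le (C := 1 + lam + lam * (q * M ^ (q - 1))) ht.1
    ((hu.continuousOn_dist hv).mono (Icc_subset_Icc_right ht.2))
    (fun s hs => hu.hasDerivAt_dist hv ⟨hs.1, hs.2.trans_le ht.2⟩) (fun s hs => by
      have hI : s ∈ Icc 0 T := ⟨hs.1.le, hs.2.le.trans ht.2⟩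
      have h1 := (abs_le.1 (abs_two_mul_mul_le (w' := u' s - v' s) hlam hL
        (abs_rpow_mul_self_lipschitz hq (huM s hI) (hvM s hI)))).2
      have h2 := mul_nonneg (hh s ⟨hs.1, hs.2.trans_le ht.2⟩) (sq_nonneg (u' s - v' s))
      linarith)
  simpa only [sub_zero] using key

/-- A solution with nonzero value at the singular end has no stationary zero. -/
theorem SolOn.ne_zero (hq : 1 < q) (hlam : 0 < lam) (hc : ContinuousOn h (Ioc 0 T))
    (hu : SolOn h lam q (Icc 0 T) (Ioc 0 T) u u' u'') (hu0 : u 0 ≠ 0) {s : ℝ}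
    (hs : s ∈ Icc 0 T) : ¬ (u s = 0 ∧ u' s = 0) := by
  rintro ⟨hs1, hs2⟩
  have hs0 : 0 < s := hs.1.lt_of_ne fun e => hu0 (e ▸ hs1)
  have hzero : SolOn h lam q (Icc 0 T) (Ioc 0 T) (fun _ => 0) (fun _ => 0) (fun _ => 0) :=
    ⟨fun t _ => hasDerivWithinAt_const _ _ _, continuousOn_const,
      fun t _ => hasDerivWithinAt_const _ _ _, continuousOn_const, fun t _ => by simp⟩
  obtain ⟨M, hM⟩ := isCompact_Icc.exists_bound_of_continuousOn hu.continuousOn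
  have hM0 : 0 ≤ M := (norm_nonneg _).trans (hM s hs)
  have hL : 0 ≤ q * M ^ (q - 1) := mul_nonneg (by linarith) (Real.rpow_nonneg hM0 _)
  have key : ∀ r ∈ Ioo 0 s, u r = 0 := by
    intro r hr
    have hsub : Icc r s ⊆ Ioc 0 T := fun t ht => ⟨hr.1.trans_le ht.1, ht.2.trans hs.2⟩
    have hsub' : Icc r s ⊆ Icc 0 T := fun t ht => ⟨hr.1.le.trans ht.1, ht.2.trans hs.2⟩
    obtain ⟨H, hH⟩ := isCompact_Icc.exists_bound_of_continuousOn (hc.mono hsub)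
    have := le_mul_exp_of_le_hasDerivAt (C := 1 + lam + lam * (q * M ^ (q - 1)) + 2 * H) hr.2.le
      ((hu.continuousOn_dist hzero).mono hsub')
      (fun t ht => hu.hasDerivAt_dist hzero ⟨hr.1.trans ht.1, ht.2.trans_le hs.2⟩) (fun t ht => by
        have hI := Ioo_subset_Icc_self ht
        have h1 := (abs_le.1 (abs_two_mul_mul_le (w' := u' t - 0) hlam hL
          (abs_rpow_mul_self_lipschitz (y := 0) hq (hM t (hsub' hI)) (by simpa using hM0)))).1
        have h2 := mul_le_mul_of_nonneg_right (abs_le.1 (hH t hI)).2 (sq_nonneg (u' t - 0))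
        have h0 : 0 ≤ H * (u t - 0) ^ 2 :=
          mul_nonneg ((norm_nonneg _).trans (hH t hI)) (sq_nonneg _)
        linarith)
    simp only [hs1, hs2, sub_zero] at this
    norm_num at this
    exact pow_eq_zero_iff two_ne_zero |>.1
      (le_antisymm (by linarith [sq_nonneg (u' r)]) (sq_nonneg _))
  refine hu0 ?_
  have hT : 0 < T := hs0.trans_le hs.2
  have h1 : Tendsto u (nhdsWithin 0 (Ioi 0)) (nhds (u 0)) := by
    have := hu.continuousOn 0 ⟨le_rfl, hT.le⟩
    exact this.mono_left (nhdsWithin_le_of_mem (mem_of_superset (Ioc_mem_nhdsGT hT)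
      Ioc_subset_Icc_self))
  have h2 : Tendsto u (nhdsWithin 0 (Ioi 0)) (nhds 0) :=
    tendsto_const_nhds.congr' (mem_of_superset (Ioo_mem_nhdsGT hs0) fun r hr => (key r hr).symm)
  exact tendsto_nhds_unique h1 h2

end HalfInterval

section Family

variable {h : ℝ → ℝ} {lam q T : ℝ} {U U' U'' : ℝ → ℝ → ℝ}

/-- Continuous dependence on the initial value at the singular end. -/
theorem continuousOn_prod_of_solOn (hq : 1 < q) (hlam : 0 < lam) (hh : ∀ t ∈ Ioo 0 T, 0 ≤ h t)
    (hU : ∀ α, SolOn h lam q (Icc 0 T) (Ioc 0 T) (U α) (U' α) (U'' α) ∧ U α 0 = α ∧ U' α 0 = 0)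
    (A : ℝ) :
    ContinuousOn (fun p : ℝ × ℝ => (U p.1 p.2 + U' p.1 p.2 * Complex.I : ℂ))
      (Icc 1 A ×ˢ Icc 0 T) := by
  obtain ⟨M, -, hM⟩ := exists_abs_le_of_potential_le hq (A ^ (q + 1) / (q + 1))
  have hb : ∀ α ∈ Icc 1 A, ∀ t ∈ Icc 0 T, |U α t| ≤ M := by
    intro α hα t ht
    refine hM _ (((hU α).1.potential_le hq hlam hh (hU α).2.2 ht).trans ?_)
    rw [(hU α).2.1]
    have : |α| ^ (q + 1) ≤ A ^ (q + 1) :=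
      Real.rpow_le_rpow (abs_nonneg _) (by rw [abs_of_pos (by linarith [hα.1])]; exact hα.2)
        (by linarith)
    have : |α| ^ (q + 1) / (q + 1) ≤ A ^ (q + 1) / (q + 1) :=
      div_le_div_of_nonneg_right this (by linarith)
    linarith [sq_nonneg α]
  set C := 1 + lam + lam * (q * M ^ (q - 1)) with hC
  refine continuousOn_prod_of_continuousOn_lipschitzOnWith _
    (Real.toNNReal (2 * Real.exp (|C| * T))) ?_ ?_
  · intro α _
    have h1 := (hU α).1.continuousOn
    have h2 := (hU α).1.2.1
    exact (Complex.continuous_ofReal.comp_continuousOn h1).add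
      ((Complex.continuous_ofReal.comp_continuousOn h2).mul continuousOn_const)
  · intro t ht
    refine LipschitzOnWith.of_dist_le_mul fun α hα β hβ => ?_
    have h1 := (hU α).1.dist_le hq hlam hh (hU β).1 (hb α hα) (hb β hβ) ht
    rw [(hU α).2.1, (hU β).2.1, (hU α).2.2, (hU β).2.2, ← hC] at h1
    rw [Real.coe_toNNReal _ (by positivity), Complex.dist_eq, Real.dist_eq]
    have he : Real.exp (C * t) ≤ Real.exp (|C| * T) ^ 2 := by
      rw [← Real.exp_nat_mul, Real.exp_le_exp]
      have e1 : C * t ≤ |C| * T := mul_le_mul (le_abs_self C) ht.2 ht.1 (abs_nonneg _)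
      have e2 : 0 ≤ |C| * T := mul_nonneg (abs_nonneg _) (ht.1.trans ht.2)
      push_cast
      linarith
    have h2 : (U α t - U β t) ^ 2 + (U' α t - U' β t) ^ 2 ≤
        (Real.exp (|C| * T) * |α - β|) ^ 2 := by
      refine h1.trans ?_
      rw [mul_pow, sq_abs, mul_comm]
      simp only [sub_self, ne_eq, OfNat.ofNat_ne_zero, not_false_eq_true, zero_pow,
        add_zero]
      exact mul_le_mul_of_nonneg_right he (sq_nonneg _)
    have h3 : 0 ≤ Real.exp (|C| * T) * |α - β| := by positivity
    have h4 : |U α t - U β t| ≤ Real.exp (|C| * T) * |α - β| :=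
      abs_le_of_sq_le_sq (by linarith [sq_nonneg (U' α t - U' β t)]) h3
    have h5 : |U' α t - U' β t| ≤ Real.exp (|C| * T) * |α - β| :=
      abs_le_of_sq_le_sq (by linarith [sq_nonneg (U α t - U β t)]) h3
    refine (Complex.norm_le_abs_re_add_abs_im _).trans ?_
    simp
    linarith

theorem eq_one_of_solOn (hq : 1 < q) (hlam : 0 < lam) (hh : ∀ t ∈ Ioo 0 T, 0 ≤ h t)
    (hU : ∀ α, SolOn h lam q (Icc 0 T) (Ioc 0 T) (U α) (U' α) (U'' α) ∧ U α 0 = α ∧ U' α 0 = 0)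
    {t : ℝ} (ht : t ∈ Icc 0 T) : U 1 t = 1 ∧ U' 1 t = 0 := by
  have hone : SolOn h lam q (Icc 0 T) (Ioc 0 T) (fun _ => 1) (fun _ => 0) (fun _ => 0) :=
    ⟨fun t _ => hasDerivWithinAt_const _ _ _, continuousOn_const,
      fun t _ => hasDerivWithinAt_const _ _ _, continuousOn_const, fun t _ => by simp⟩
  obtain ⟨M, hM⟩ := isCompact_Icc.exists_bound_of_continuousOn (hU 1).1.continuousOn
  have h1 := (hU 1).1.dist_le hq hlam hh hone (M := max M 1)
    (fun t ht => (hM t ht).trans (le_max_left _ _)) (fun t ht => by simp) ht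
  rw [(hU 1).2.1, (hU 1).2.2] at h1
  simp only [sub_self, ne_eq, OfNat.ofNat_ne_zero, not_false_eq_true, zero_pow, add_zero,
    zero_mul] at h1 
  have h2 := sq_nonneg (U 1 t - 1)
  have h3 := sq_nonneg (U' 1 t)
  constructor
  · exact sub_eq_zero.1 (pow_eq_zero_iff two_ne_zero |>.1 (by linarith))
  · exact pow_eq_zero_iff two_ne_zero |>.1 (by linarith)

end Family

/-- A homotopy in `ℂ \ {0}` from the constant path `1` whose initial points are positive reals:
the angle of the final points, followed along the homotopy, agrees with the angle followed along
the final path. -/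
theorem exists_angle_of_homotopy {z : ℝ → ℝ → ℂ} {a : ℝ → ℝ} {A T : ℝ} (hA : 1 ≤ A) (hT : 0 < T)
    (hz : ContinuousOn (fun p : ℝ × ℝ => z p.1 p.2) (Icc 1 A ×ˢ Icc 0 T))
    (hz0 : ∀ α ∈ Icc 1 A, ∀ t ∈ Icc 0 T, z α t ≠ 0) (hz1 : ∀ t ∈ Icc 0 T, z 1 t = 1)
    (hzα : ∀ α ∈ Icc 1 A, z α 0 = α) (ha : ContinuousOn a (Icc 1 A)) (ha1 : a 1 = 0)
    (haz : ∀ α ∈ Icc 1 A, z α T = ‖z α T‖ * Complex.exp (a α * Complex.I)) :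
    ∃ θ : ℝ → ℝ, ContinuousOn θ (Icc 0 T) ∧ θ 0 = 0 ∧ θ T = a A ∧
      ∀ t ∈ Icc 0 T, z A t = ‖z A t‖ * Complex.exp (θ t * Complex.I) := by
  let cα : unitInterval → ℝ := fun s => 1 + s * (A - 1)
  let ct : unitInterval → ℝ := fun s => s * T
  have hcα : ∀ s, cα s ∈ Icc 1 A := fun s => by
    have := s.2.1
    have := s.2.2
    constructor <;> simp only [cα] <;> nlinarith
  have hct : ∀ s, ct s ∈ Icc 0 T := fun s => by
    have := s.2.1
    have := s.2.2
    constructor <;> simp only [ct] <;> nlinarith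
  have hcαc : Continuous cα := by fun_prop
  have hctc : Continuous ct := by fun_prop
  have cov := Complex.isCoveringMap_exp
  have hzc : Continuous fun p : unitInterval × unitInterval => z (cα p.1) (ct p.2) :=
    hz.comp_continuous (f := fun p : unitInterval × unitInterval => (cα p.1, ct p.2))
      (by fun_prop) fun p => ⟨hcα _, hct _⟩
  let H : C(unitInterval × unitInterval, {z : ℂ // z ≠ 0}) :=
    ⟨fun p => ⟨z (cα p.1) (ct p.2), hz0 _ (hcα _) _ (hct _)⟩, hzc.subtype_mk _⟩
  let L := cov.liftHomotopy H (ContinuousMap.const _ 0) fun t => by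
    apply Subtype.ext
    simp [H, cα, hz1 _ (hct t)]
  have hL : ∀ s t, Complex.exp (L (s, t)) = z (cα s) (ct t) := fun s t =>
    congrArg Subtype.val (congrFun (cov.liftHomotopy_lifts H _ _) (s, t))
  have hL0 : ∀ t, L (0, t) = 0 := fun t => cov.liftHomotopy_zero H _ _ t
  have cov_eq : ∀ g : unitInterval → ℂ, Continuous g → ∀ t, g 0 = 0 →
      (∀ s, Complex.exp (g s) = z (cα s) (ct t)) → ∀ s, L (s, t) = g s := by
    intro g hg t hg0 hgz s
    refine congrFun (cov.eq_of_comp_eq (g₁ := fun s => L (s, t)) (by fun_prop) hg ?_ 0 ?_) s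
    · funext s
      apply Subtype.ext
      simp [hL, hgz]
    · rw [hL0, hg0]
  have e0 : L (1, 0) = Real.log A := by
    rw [cov_eq (fun s => ((Real.log (cα s) : ℝ) : ℂ)) ?_ 0 (by simp [cα]) ?_ 1]
    · simp [cα]
    · exact Complex.continuous_ofReal.comp
        (hcαc.log fun s => (zero_lt_one.trans_le (hcα s).1).ne')
    · intro s
      have : ct 0 = 0 := by simp [ct]
      rw [this, hzα _ (hcα s), ← Complex.ofReal_exp,
        Real.exp_log (zero_lt_one.trans_le (hcα s).1)]
  have e1 : (L (1, 1)).im = a A := by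
    have hT1 : ct 1 = T := by simp [ct]
    have hzT : Continuous fun s : unitInterval => z (cα s) T := by
      have := hzc.comp (g := fun p : unitInterval × unitInterval => z (cα p.1) (ct p.2))
        (f := fun s => (s, 1)) (by fun_prop)
      simpa [Function.comp_def, hT1] using this
    have hne : ∀ s, ‖z (cα s) T‖ ≠ 0 := fun s =>
      norm_ne_zero_iff.2 (hz0 _ (hcα s) _ ⟨hT.le, le_rfl⟩)
    rw [cov_eq (fun s => ((Real.log ‖z (cα s) T‖ : ℝ) : ℂ) + a (cα s) * Complex.I) ?_ 1 ?_ ?_ 1]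
    · simp [cα]
    · exact (Complex.continuous_ofReal.comp (hzT.norm.log hne)).add
        ((Complex.continuous_ofReal.comp (ha.comp_continuous hcαc hcα)).mul continuous_const)
    · simp [cα, ha1, hz1 T ⟨hT.le, le_rfl⟩]
    · intro s
      rw [hT1, Complex.exp_add, ← Complex.ofReal_exp,
        Real.exp_log (lt_of_le_of_ne (norm_nonneg _) (hne s).symm), ← haz _ (hcα s)]
  let r : ℝ → unitInterval := fun t => projIcc 0 1 zero_le_one (t / T)
  have hr : Continuous r := continuous_projIcc.comp (by fun_prop)
  refine ⟨fun t => (L (1, r t)).im, ?_, ?_, ?_, ?_⟩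
  · exact (Complex.continuous_im.comp (L.continuous.comp (by fun_prop))).continuousOn
  · have : r 0 = 0 := by simp only [r, zero_div]; exact projIcc_left _
    simp only [this, e0, Complex.ofReal_im]
  · have : r T = 1 := by simp only [r, div_self hT.ne']; exact projIcc_right _
    simp only [this, e1]
  · intro t ht
    have hrt : ct (r t) = t := by
      have : t / T ∈ Icc (0 : ℝ) 1 := ⟨div_nonneg ht.1 hT.le, (div_le_one hT).2 ht.2⟩
      simp only [ct, r, projIcc_of_mem _ this]
      field_simp
    have hA1 : cα 1 = A := by simp [cα]
    have h := hL 1 (r t)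
    rw [hrt, hA1] at h
    rw [← h, Complex.norm_exp, Complex.ofReal_exp, ← Complex.exp_add, Complex.re_add_im]

/-- The polar angle of `(u_A, u_A')` along `[0, T]` ends at the value `a A` of the angle that is
followed in the initial value. -/
theorem exists_angle_of_solOn {h : ℝ → ℝ} {lam q T : ℝ} {U U' U'' : ℝ → ℝ → ℝ} (hT : 0 < T)
    (hq : 1 < q) (hlam : 0 < lam) (hc : ContinuousOn h (Ioc 0 T)) (hh : ∀ t ∈ Ioo 0 T, 0 ≤ h t)
    (hU : ∀ α, SolOn h lam q (Icc 0 T) (Ioc 0 T) (U α) (U' α) (U'' α) ∧ U α 0 = α ∧ U' α 0 = 0)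
    {a : ℝ → ℝ} (ha : ContinuousOn a (Ioi 0)) (ha1 : a 1 = 0)
    (haU : ∀ α, 0 < α → U α T = enorm2 (U α T, U' α T) * Real.cos (a α) ∧
      U' α T = enorm2 (U α T, U' α T) * Real.sin (a α)) {A : ℝ} (hA : 1 ≤ A) :
    ∃ θ : ℝ → ℝ, ContinuousOn θ (Icc 0 T) ∧ θ 0 = 0 ∧ θ T = a A ∧
      ∀ t ∈ Icc 0 T, ∃ R > 0, U A t = R * Real.cos (θ t) ∧ U' A t = R * Real.sin (θ t) := by
  have hpos : ∀ α ∈ Icc 1 A, 0 < α := fun α hα => zero_lt_one.trans_le hα.1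
  have hne : ∀ α ∈ Icc 1 A, ∀ t ∈ Icc 0 T, (U α t + U' α t * Complex.I : ℂ) ≠ 0 := by
    intro α hα t ht h0
    refine (hU α).1.ne_zero hq hlam hc (by rw [(hU α).2.1]; exact (hpos α hα).ne') ht ⟨?_, ?_⟩
    · simpa using congrArg Complex.re h0
    · simpa using congrArg Complex.im h0
  obtain ⟨θ, hθ, hθ0, hθT, hθz⟩ := exists_angle_of_homotopy
    (z := fun α t => (U α t + U' α t * Complex.I : ℂ)) (a := a) hA hT
    (continuousOn_prod_of_solOn hq hlam hh hU A) hne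
    (fun t ht => by simp [eq_one_of_solOn hq hlam hh hU ht])
    (fun α _ => by simp [(hU α).2.1, (hU α).2.2])
    (ha.mono hpos) ha1
    (fun α hα => by
      have hn : ‖(U α T + U' α T * Complex.I : ℂ)‖ = enorm2 (U α T, U' α T) :=
        Complex.norm_add_mul_I _ _
      rw [hn, Complex.exp_mul_I]
      obtain ⟨h1, h2⟩ := haU α (hpos α hα)
      apply Complex.ext
      · simpa [← Complex.ofReal_cos, ← Complex.ofReal_sin] using h1
      · simpa [← Complex.ofReal_cos, ← Complex.ofReal_sin] using h2)
  refine ⟨θ, hθ, hθ0, hθT, fun t ht =>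
    ⟨_, norm_pos_iff.2 (hne A ⟨hA, le_rfl⟩ t ht), ?_, ?_⟩⟩
  · have := congrArg Complex.re (hθz t ht)
    rw [Complex.exp_mul_I] at this
    simpa [← Complex.ofReal_cos, ← Complex.ofReal_sin] using this
  · have := congrArg Complex.im (hθz t ht)
    rw [Complex.exp_mul_I] at this
    simpa [← Complex.ofReal_cos, ← Complex.ofReal_sin] using this

theorem lt_of_forall_crossing {f : ℝ → ℝ} {a b c t : ℝ} (hf : ContinuousOn f (Icc a b))
    (hb : f b ≠ c) (hR : ∀ s ∈ Ioo a b, f s = c → ∀ᶠ x in nhdsWithin s (Ioi s), f x < c)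
    (hL : ∀ s ∈ Ioo a b, f s = c → ∀ᶠ x in nhdsWithin s (Iio s), c < f x)
    (ht : t ∈ Ioo a b) (htc : f t = c) {s : ℝ} (hs : s ∈ Ioc t b) : f s < c := by
  by_contra! hcs
  obtain ⟨t₁, ⟨ht₁, ht₁s⟩, hft₁⟩ :
      ∃ t₁ ∈ Ioo t s, f t₁ < c := by
    have := (hR t ht htc).and (Ioo_mem_nhdsGT hs.1)
    obtain ⟨x, hx1, hx2⟩ := this.exists
    exact ⟨x, hx2, hx1⟩
  have hsub : Icc t₁ s ⊆ Icc a b := Icc_subset_Icc (ht.1.trans ht₁).le hs.2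
  have hclosed : IsClosed (Icc t₁ s ∩ f ⁻¹' Ici c) :=
    (hf.mono hsub).preimage_isClosed_of_isClosed isClosed_Icc isClosed_Ici
  obtain ⟨m, ⟨hm, hcm⟩, hmin⟩ :=
    (isCompact_Icc.of_isClosed_subset hclosed inter_subset_left).exists_isLeast
      ⟨s, ⟨ht₁s.le, le_rfl⟩, hcs⟩
  have hfm : f m = c := by
    obtain ⟨x, hx, hxc⟩ := intermediate_value_Icc hm.1
      (hf.mono ((Icc_subset_Icc_right hm.2).trans hsub)) ⟨hft₁.le, hcm⟩
    rwa [le_antisymm hx.2 (hmin ⟨⟨hx.1, hx.2.trans hm.2⟩, hxc.ge⟩)] at hxc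
  have hm₁ : t₁ < m := hm.1.lt_of_ne (by rintro rfl; exact hft₁.ne hfm)
  have hmb : m < b := (hm.2.trans hs.2).lt_of_ne (by rintro rfl; exact hb hfm)
  obtain ⟨x, hx, hx₁, hxm⟩ :=
    ((hL m ⟨(ht.1.trans ht₁).trans hm₁, hmb⟩ hfm).and (Ioo_mem_nhdsLT hm₁)).exists
  exact hxm.not_ge (hmin ⟨⟨hx₁.le, hxm.le.trans hm.2⟩, hx.le⟩)

theorem gt_of_forall_crossing {f : ℝ → ℝ} {a b c t : ℝ} (hf : ContinuousOn f (Icc a b))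
    (ha : f a ≠ c) (hR : ∀ s ∈ Ioo a b, f s = c → ∀ᶠ x in nhdsWithin s (Ioi s), f x < c)
    (hL : ∀ s ∈ Ioo a b, f s = c → ∀ᶠ x in nhdsWithin s (Iio s), c < f x)
    (ht : t ∈ Ioo a b) (htc : f t = c) {s : ℝ} (hs : s ∈ Ico a t) : c < f s := by
  have hmem : ∀ x ∈ Ioo (-b) (-a), -x ∈ Ioo a b := fun x hx =>
    ⟨by linarith [hx.2], by linarith [hx.1]⟩
  have := lt_of_forall_crossing (f := fun x => -f (-x)) (a := -b) (b := -a) (c := -c) (t := -t)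
    (s := -s) (hf.comp continuousOn_neg fun x hx => ⟨by linarith [hx.2], by linarith [hx.1]⟩).neg
    (by simpa using ha)
    (fun x hx hxc => by
      have := tendsto_neg_nhdsGT.eventually (hL (-x) (hmem x hx) (by simpa using hxc))
      simpa using this)
    (fun x hx hxc => by
      have := tendsto_neg_nhdsLT.eventually (hR (-x) (hmem x hx) (by simpa using hxc))
      simpa using this)
    ⟨by linarith [ht.2], by linarith [ht.1]⟩ (by simpa using htc)
    ⟨by linarith [hs.2], by linarith [hs.1]⟩
  simpa using this

theorem Real.lt_zero_of_sin_neg {x : ℝ} (h : Real.sin x < 0) (hx : x < Real.pi) : x < 0 := by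
  by_contra! hc
  exact h.not_ge (Real.sin_nonneg_of_nonneg_of_le_pi hc hx.le)

/-- In phase-plane polar coordinates, the angle crosses the vertical axis clockwise. -/
theorem eventually_angle_of_cos_eq_zero {u u' θ : ℝ → ℝ} {t : ℝ} (hu : HasDerivAt u (u' t) t)
    (hθ : ContinuousAt θ t)
    (hpol : ∀ᶠ x in nhds t, ∃ R > 0, u x = R * Real.cos (θ x) ∧ u' x = R * Real.sin (θ x))
    (hcos : Real.cos (θ t) = 0) :
    (∀ᶠ x in nhdsWithin t (Ioi t), θ x < θ t) ∧ ∀ᶠ x in nhdsWithin t (Iio t), θ t < θ x := by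
  obtain ⟨R, hR, hut, hut'⟩ := hpol.self_of_nhds
  rw [hcos, mul_zero] at hut
  set e := Real.sin (θ t) with he
  have he2 : e * e = 1 := by nlinarith [Real.sin_sq_add_cos_sq (θ t)]
  have hslope : ∀ᶠ x in nhdsWithin t {t}ᶜ, 0 < slope (fun x => e * u x) t x := by
    refine (hasDerivAt_iff_tendsto_slope.1 (hu.const_mul e)).eventually (lt_mem_nhds ?_)
    rw [hut']
    nlinarith
  have hnear : ∀ᶠ x in nhds t, |θ x - θ t| < Real.pi := by
    have := Metric.tendsto_nhds.1 hθ Real.pi Real.pi_pos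
    simpa only [Real.dist_eq] using this
  have hev : ∀ᶠ x in nhdsWithin t {t}ᶜ, (t < x → θ x < θ t) ∧ (x < t → θ t < θ x) := by
    filter_upwards [hslope, hnear.filter_mono nhdsWithin_le_nhds,
      hpol.filter_mono nhdsWithin_le_nhds] with x hx1 hx2 hx3
    obtain ⟨r, hr, hux, -⟩ := hx3
    have hcx : e * u x = -(r * Real.sin (θ x - θ t)) := by
      have : Real.cos (θ x) = -(e * Real.sin (θ x - θ t)) := by
        conv_lhs => rw [show θ x = θ t + (θ x - θ t) by ring, Real.cos_add, hcos]
        ring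
      rw [hux, this]
      linear_combination (-(r * Real.sin (θ x - θ t))) * he2
    rw [slope_def_field, hut, mul_zero, sub_zero, hcx] at hx1
    obtain ⟨h1, h2⟩ := abs_lt.1 hx2
    constructor
    · intro htx
      have h3 := (div_pos_iff_of_pos_right (sub_pos.2 htx)).1 hx1
      have h4 : Real.sin (θ x - θ t) < 0 := by
        by_contra! h; linarith [mul_nonneg hr.le h]
      linarith [Real.lt_zero_of_sin_neg h4 h2]
    · intro hxt
      have h3 : -(r * Real.sin (θ x - θ t)) < 0 := by
        by_contra! h
        exact hx1.not_ge (div_nonpos_of_nonneg_of_nonpos h (sub_neg.2 hxt).le)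
      have h4 : Real.sin (-(θ x - θ t)) < 0 := by
        rw [Real.sin_neg]
        by_contra! h; nlinarith
      linarith [Real.lt_zero_of_sin_neg h4 (by linarith)]
  constructor
  · filter_upwards [hev.filter_mono (nhdsWithin_mono t fun x (hx : t < x) => hx.ne'),
      self_mem_nhdsWithin] with x hx hx' using hx.1 hx'
  · filter_upwards [hev.filter_mono (nhdsWithin_mono t fun x (hx : x < t) => hx.ne),
      self_mem_nhdsWithin] with x hx hx' using hx.2 hx'

theorem ncard_zeros_of_angle {u u' θ : ℝ → ℝ} {d : ℝ} {k : ℕ} (hd : 0 < d)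
    (hu : ∀ t ∈ Ioo 0 d, HasDerivAt u (u' t) t) (hθ : ContinuousOn θ (Icc 0 d))
    (hpol : ∀ t ∈ Ioo 0 d, ∃ R > 0, u t = R * Real.cos (θ t) ∧ u' t = R * Real.sin (θ t))
    (hθ0 : θ 0 = 0) (hθd : θ d = -(2 * k * Real.pi)) :
    {t ∈ Ioo 0 d | u t = 0}.Finite ∧ {t ∈ Ioo 0 d | u t = 0}.ncard = 2 * k := by
  have hpi := Real.pi_pos
  have hzero : ∀ t ∈ Ioo 0 d, (u t = 0 ↔ Real.cos (θ t) = 0) := by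
    intro t ht
    obtain ⟨R, hR, hut, -⟩ := hpol t ht
    rw [hut, mul_eq_zero, or_iff_right hR.ne']
  have hcross : ∀ t ∈ Ioo 0 d, Real.cos (θ t) = 0 →
      (∀ᶠ x in nhdsWithin t (Ioi t), θ x < θ t) ∧ ∀ᶠ x in nhdsWithin t (Iio t), θ t < θ x :=
    fun t ht => eventually_angle_of_cos_eq_zero (hu t ht)
      (hθ.continuousAt (Icc_mem_nhds ht.1 ht.2)) (mem_of_superset (Ioo_mem_nhds ht.1 ht.2) hpol)
  have hc0 : ∀ t, Real.cos (θ t) = 0 → θ 0 ≠ θ t := by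
    intro t ht h
    rw [← h, hθ0, Real.cos_zero] at ht
    exact one_ne_zero ht
  have hcd : ∀ t, Real.cos (θ t) = 0 → θ d ≠ θ t := by
    intro t ht h
    have := Real.cos_nat_mul_two_pi k
    rw [← h, hθd, Real.cos_neg, show 2 * (k : ℝ) * Real.pi = k * (2 * Real.pi) by ring, this] at ht
    exact one_ne_zero ht
  have hright : ∀ t ∈ Ioo 0 d, Real.cos (θ t) = 0 → ∀ s ∈ Ioc t d, θ s < θ t := by
    intro t ht hct s hs
    exact lt_of_forall_crossing hθ (hcd t hct)
      (fun r hr hrt => hrt ▸ (hcross r hr (hrt ▸ hct)).1)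
      (fun r hr hrt => hrt ▸ (hcross r hr (hrt ▸ hct)).2) ht rfl hs
  have hleft : ∀ t ∈ Ioo 0 d, Real.cos (θ t) = 0 → θ t < θ 0 := by
    intro t ht hct
    exact gt_of_forall_crossing hθ (hc0 t hct)
      (fun r hr hrt => hrt ▸ (hcross r hr (hrt ▸ hct)).1)
      (fun r hr hrt => hrt ▸ (hcross r hr (hrt ▸ hct)).2) ht rfl ⟨le_rfl, ht.1⟩
  have hinj : InjOn θ {t ∈ Ioo 0 d | u t = 0} := by
    rintro s ⟨hs, hs0⟩ t ⟨ht, ht0⟩ hst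
    rcases lt_trichotomy s t with h | h | h
    · exact absurd hst (hright s hs ((hzero s hs).1 hs0) t ⟨h, ht.2.le⟩).ne'
    · exact h
    · exact absurd hst (hright t ht ((hzero t ht).1 ht0) s ⟨h, hs.2.le⟩).ne
  have himage : θ '' {t ∈ Ioo 0 d | u t = 0} =
      (fun j : ℕ => -(Real.pi / 2 + j * Real.pi)) '' (Finset.range (2 * k) : Set ℕ) := by
    ext c
    constructor
    · rintro ⟨t, ⟨ht, ht0⟩, rfl⟩
      have hct := (hzero t ht).1 ht0
      have h1 := hleft t ht hct
      have h2 := hright t ht hct d ⟨ht.2, le_rfl⟩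
      obtain ⟨m, hm⟩ := Real.cos_eq_zero_iff.1 hct
      rw [hm, hθ0] at h1
      rw [hm, hθd] at h2
      have h1' : (m : ℝ) < 0 := by
        by_contra! h; nlinarith
      have h2' : (-(2 * k) - 1 : ℝ) < m := by
        by_contra! h; nlinarith
      have h1'' : m < 0 := by exact_mod_cast h1'
      have h2'' : -(2 * k : ℤ) - 1 < m := by exact_mod_cast h2'
      refine ⟨(-m - 1).toNat, ?_, ?_⟩
      · simp only [Finset.coe_range, mem_Iio]; omega
      · have : (((-m - 1).toNat : ℤ) : ℝ) = ((-m - 1 : ℤ) : ℝ) := by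
          rw [Int.toNat_of_nonneg (by omega)]
        rw [Int.cast_natCast] at this
        simp only [this, hm]
        push_cast
        ring
    · rintro ⟨j, hj, rfl⟩
      have hj' : (j : ℝ) + 1 ≤ 2 * k := by
        simp only [Finset.coe_range, mem_Iio] at hj
        exact_mod_cast hj
      obtain ⟨t, ht, htj⟩ := intermediate_value_Ioo' hd.le hθ
        (show -(Real.pi / 2 + j * Real.pi) ∈ Ioo (θ d) (θ 0) by
          rw [hθ0, hθd]
          constructor
          · nlinarith
          · have : 0 ≤ j * Real.pi := by positivity
            linarith)
      refine ⟨t, ⟨ht, (hzero t ht).2 ?_⟩, htj⟩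
      rw [htj, Real.cos_neg, Real.cos_eq_zero_iff]
      exact ⟨j, by push_cast; ring⟩
  refine ⟨Set.Finite.of_finite_image ?_ hinj, ?_⟩
  · rw [himage]
    exact (Finset.finite_toSet _).image _
  · rw [← hinj.ncard_image, himage, ncard_image_of_injective, ncard_coe_finset,
      Finset.card_range]
    intro i j hij
    have : (i : ℝ) * Real.pi = j * Real.pi := by simpa using hij
    exact_mod_cast mul_right_cancel₀ hpi.ne' this

section Gluing

variable {f g f' g' : ℝ → ℝ} {S : Set ℝ} {c : ℝ}

theorem notMem_closure_inter_Iic {t : ℝ} (ht : c < t) : t ∉ closure (S ∩ Iic c) := fun h =>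
  ht.not_ge (closure_minimal inter_subset_right isClosed_Iic h)

theorem notMem_closure_inter_Ici {t : ℝ} (ht : t < c) : t ∉ closure (S ∩ Ici c) := fun h =>
  ht.not_ge (closure_minimal inter_subset_right isClosed_Ici h)

theorem hasDerivWithinAt_glue
    (hf : ∀ t ∈ S ∩ Iic c, HasDerivWithinAt f (f' t) (S ∩ Iic c) t)
    (hg : ∀ t ∈ S ∩ Ici c, HasDerivWithinAt g (g' t) (S ∩ Ici c) t)
    (hfg : f c = g c) (hfg' : f' c = g' c) {t : ℝ} (ht : t ∈ S) :
    HasDerivWithinAt (fun t => if t ≤ c then f t else g t) (if t ≤ c then f' t else g' t) S t := by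
  have hL : ∀ x ∈ S ∩ Iic c, (if x ≤ c then f x else g x) = f x := fun x hx => if_pos hx.2
  have hR : ∀ x ∈ S ∩ Ici c, (if x ≤ c then f x else g x) = g x := fun x hx => by
    split_ifs with h
    · rw [le_antisymm h hx.2, hfg]
    · rfl
  have hS : S = S ∩ Iic c ∪ S ∩ Ici c := by
    rw [← inter_union_distrib_left, Iic_union_Ici, inter_univ]
  have h1 : HasDerivWithinAt (fun t => if t ≤ c then f t else g t)
      (if t ≤ c then f' t else g' t) (S ∩ Iic c) t := by
    by_cases htc : t ≤ c
    · rw [if_pos htc]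
      exact (hf t ⟨ht, htc⟩).congr hL (hL t ⟨ht, htc⟩)
    · exact hasDerivWithinAt_iff_hasFDerivWithinAt.2
        (HasFDerivWithinAt.of_notMem_closure (notMem_closure_inter_Iic (not_le.1 htc)))
  have h2 : HasDerivWithinAt (fun t => if t ≤ c then f t else g t)
      (if t ≤ c then f' t else g' t) (S ∩ Ici c) t := by
    by_cases htc : c ≤ t
    · have : (if t ≤ c then f' t else g' t) = g' t := by
        split_ifs with h
        · rw [le_antisymm h htc, hfg']
        · rfl
      rw [this]
      exact (hg t ⟨ht, htc⟩).congr hR (hR t ⟨ht, htc⟩)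
    · exact hasDerivWithinAt_iff_hasFDerivWithinAt.2
        (HasFDerivWithinAt.of_notMem_closure (notMem_closure_inter_Ici (not_le.1 htc)))
  rw [hS]
  exact h1.union h2

theorem continuousOn_glue (hf : ContinuousOn f (S ∩ Iic c)) (hg : ContinuousOn g (S ∩ Ici c))
    (hfg : f c = g c) : ContinuousOn (fun t => if t ≤ c then f t else g t) S := by
  refine ContinuousOn.if (fun t ht => ?_) (hf.mono ?_) (hg.mono ?_)
  · rw [frontier_Iic_subset c ht.2, hfg]
  · exact inter_subset_inter_right _ (isClosed_Iic.closure_subset)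
  · exact inter_subset_inter_right _
      (closure_minimal (fun t (h : ¬ t ≤ c) => (not_le.1 h).le) isClosed_Ici)

end Gluing

theorem SolOn.glue {h : ℝ → ℝ} {lam q d t₀ : ℝ} {u u' u'' v v' v'' : ℝ → ℝ}
    (ht₀ : t₀ ∈ Ioo 0 d) (hu : SolOn h lam q (Icc 0 t₀) (Ioc 0 t₀) u u' u'')
    (hv : SolOn h lam q (Icc t₀ d) (Ico t₀ d) v v' v'') (huv : u t₀ = v t₀)
    (huv' : u' t₀ = v' t₀) :
    SolOn h lam q (Icc 0 d) (Ioo 0 d) (fun t => if t ≤ t₀ then u t else v t)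
      (fun t => if t ≤ t₀ then u' t else v' t) (fun t => if t ≤ t₀ then u'' t else v'' t) := by
  have e1 : Icc 0 d ∩ Iic t₀ = Icc 0 t₀ := by
    ext t; exact ⟨fun h => ⟨h.1.1, h.2⟩, fun h => ⟨⟨h.1, h.2.trans ht₀.2.le⟩, h.2⟩⟩
  have e2 : Icc 0 d ∩ Ici t₀ = Icc t₀ d := by
    ext t; exact ⟨fun h => ⟨h.2, h.1.2⟩, fun h => ⟨⟨ht₀.1.le.trans h.1, h.2⟩, h.1⟩⟩
  have e3 : Ioo 0 d ∩ Iic t₀ = Ioc 0 t₀ := by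
    ext t; exact ⟨fun h => ⟨h.1.1, h.2⟩, fun h => ⟨⟨h.1, h.2.trans_lt ht₀.2⟩, h.2⟩⟩
  have e4 : Ioo 0 d ∩ Ici t₀ = Ico t₀ d := by
    ext t; exact ⟨fun h => ⟨h.2, h.1.2⟩, fun h => ⟨⟨ht₀.1.trans_le h.1, h.2⟩, h.1⟩⟩
  obtain ⟨hu1, hu2, hu3, hu4, hu5⟩ := hu
  obtain ⟨hv1, hv2, hv3, hv4, hv5⟩ := hv
  have huv'' : u'' t₀ = v'' t₀ := by
    have h1 := hu5 t₀ ⟨ht₀.1, le_rfl⟩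
    have h2 := hv5 t₀ ⟨le_rfl, ht₀.2⟩
    rw [huv, huv'] at h1
    linarith
  refine ⟨fun t ht => ?_, ?_, fun t ht => ?_, ?_, fun t ht => ?_⟩
  · exact hasDerivWithinAt_glue (by rwa [e1]) (by rwa [e2]) huv huv' ht
  · exact continuousOn_glue (by rwa [e1]) (by rwa [e2]) huv'
  · exact hasDerivWithinAt_glue (by rwa [e3]) (by rwa [e4]) huv' huv'' ht
  · exact continuousOn_glue (by rwa [e3]) (by rwa [e4]) huv''
  · by_cases htc : t ≤ t₀
    · simpa only [if_pos htc] using hu5 t ⟨ht.1, htc⟩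
    · simpa only [if_neg htc] using hv5 t ⟨(not_le.1 htc).le, ht.2⟩

theorem SolOn.reflect {h : ℝ → ℝ} {lam q d t₀ : ℝ} {v v' v'' : ℝ → ℝ}
    (hv : SolOn h lam q (Icc t₀ d) (Ico t₀ d) v v' v'') :
    SolOn (fun s => -h (d - s)) lam q (Icc 0 (d - t₀)) (Ioc 0 (d - t₀)) (fun s => v (d - s))
      (fun s => -v' (d - s)) (fun s => v'' (d - s)) := by
  have m1 : MapsTo (fun s => d - s) (Icc 0 (d - t₀)) (Icc t₀ d) := fun s hs =>
    ⟨by linarith [hs.2], by linarith [hs.1]⟩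
  have m2 : MapsTo (fun s => d - s) (Ioc 0 (d - t₀)) (Ico t₀ d) := fun s hs =>
    ⟨by linarith [hs.2], by linarith [hs.1]⟩
  have hd : ∀ (S : Set ℝ) (s : ℝ), HasDerivWithinAt (fun s => d - s) (-1) S s := fun S s =>
    ((hasDerivAt_id s).const_sub d).hasDerivWithinAt
  have hc : Continuous fun s : ℝ => d - s := by fun_prop
  obtain ⟨hv1, hv2, hv3, hv4, hv5⟩ := hv
  refine ⟨fun s hs => ?_, (hv2.comp hc.continuousOn m1).neg, fun s hs => ?_,
    hv4.comp hc.continuousOn m2, fun s hs => ?_⟩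
  · exact ((hv1 _ (m1 hs)).comp s (hd _ s) m1).congr_deriv (mul_neg_one _)
  · exact ((hv3 _ (m2 hs)).comp s (hd _ s) m2).neg.congr_deriv (by ring)
  · have := hv5 _ (m2 hs)
    linarith

theorem stmt_14
    (d lam : ℝ) (hd : 0 < d) (hlam : 0 < lam)
    (n m₁ m₂ : ℤ) (hn : 3 ≤ n)
    (hm₁0 : 0 ≤ m₁) (hm₁n : m₁ ≤ n - 2) (hm₂0 : 0 ≤ m₂) (hm₂n : m₂ ≤ n - 2)
    (h : ℝ → ℝ) (hC1 : ContDiffOn ℝ 1 h (Set.Ioo 0 d))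
    (hder : ∀ t ∈ Set.Ioo 0 d, deriv h t < 0)
    (hlim0 : Filter.Tendsto (fun t => t * h t) (nhdsWithin 0 (Set.Ioi 0))
      (nhds ((n : ℝ) - (m₁ : ℝ) - 1)))
    (hlimd : Filter.Tendsto (fun t => (t - d) * h t) (nhdsWithin d (Set.Iio d))
      (nhds ((n : ℝ) - (m₂ : ℝ) - 1)))
    (q : ℝ) (hq1 : 1 < q)
    (t₀ : ℝ) (ht₀ : t₀ ∈ Set.Ioo 0 d)
    (hpos : ∀ t ∈ Set.Ioo 0 t₀, 0 < h t) (hneg : ∀ t ∈ Set.Ioo t₀ d, h t < 0)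
    (U U' U'' : ℝ → ℝ → ℝ)
    (hU : ∀ α : ℝ, SolOn h lam q (Set.Icc 0 t₀) (Set.Ioc 0 t₀) (U α) (U' α) (U'' α) ∧
      U α 0 = α ∧ U' α 0 = 0)
    (hUuniq : ∀ α : ℝ, ∀ u u' u'' : ℝ → ℝ,
      SolOn h lam q (Set.Icc 0 t₀) (Set.Ioc 0 t₀) u u' u'' → u 0 = α → u' 0 = 0 →
      ∀ t ∈ Set.Icc 0 t₀, u t = U α t ∧ u' t = U' α t)
    (V V' V'' : ℝ → ℝ → ℝ)
    (hV : ∀ β : ℝ, SolOn h lam q (Set.Icc t₀ d) (Set.Ico t₀ d) (V β) (V' β) (V'' β) ∧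
      V β d = β ∧ V' β d = 0)
    (hVuniq : ∀ β : ℝ, ∀ u u' u'' : ℝ → ℝ,
      SolOn h lam q (Set.Icc t₀ d) (Set.Ico t₀ d) u u' u'' → u d = β → u' d = 0 →
      ∀ t ∈ Set.Icc t₀ d, u t = V β t ∧ u' t = V' β t)
    (a : ℝ → ℝ) (haCont : ContinuousOn a (Set.Ioi 0)) (ha1 : a 1 = 0)
    (haAngle : ∀ α : ℝ, 0 < α →
      U α t₀ = enorm2 (U α t₀, U' α t₀) * Real.cos (a α) ∧
      U' α t₀ = enorm2 (U α t₀, U' α t₀) * Real.sin (a α))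
    (b : ℝ → ℝ) (hbCont : ContinuousOn b (Set.Ioi 0)) (hb1 : b 1 = 0)
    (hbAngle : ∀ β : ℝ, 0 < β →
      V β t₀ = enorm2 (V β t₀, V' β t₀) * Real.cos (b β) ∧
      V' β t₀ = enorm2 (V β t₀, V' β t₀) * Real.sin (b β))
    (k : ℕ) (hk : 0 < k)
    (α β : ℝ) (hα : 1 < α) (hβ : 1 < β)
    (hab : a α = b β - 2 * (k : ℝ) * Real.pi)
    (hnorm : enorm2 (U α t₀, U' α t₀) = enorm2 (V β t₀, V' β t₀)) :
    (U α t₀, U' α t₀) = (V β t₀, V' β t₀) ∧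
    SolOn h lam q (Set.Icc 0 d) (Set.Ioo 0 d)
      (fun t => if t ≤ t₀ then U α t else V β t)
      (fun t => if t ≤ t₀ then U' α t else V' β t)
      (fun t => if t ≤ t₀ then U'' α t else V'' β t) ∧
    (if (0 : ℝ) ≤ t₀ then U' α 0 else V' β 0) = 0 ∧
    (if d ≤ t₀ then U' α d else V' β d) = 0 ∧
    {t ∈ Set.Ioo 0 d | (if t ≤ t₀ then U α t else V β t) = 0}.Finite ∧
    {t ∈ Set.Ioo 0 d | (if t ≤ t₀ then U α t else V β t) = 0}.ncard = 2 * k := by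
  have hd₀ : 0 < d - t₀ := sub_pos.2 ht₀.2
  have hhc := hC1.continuousOn
  obtain ⟨θ, hθ, hθ0, hθT, hθpol⟩ := exists_angle_of_solOn ht₀.1 hq1 hlam
    (hhc.mono fun t ht => ⟨ht.1, ht.2.trans_lt ht₀.2⟩) (fun t ht => (hpos t ht).le) hU haCont ha1
    haAngle hα.le
  obtain ⟨φ, hφ, hφ0, hφT, hφpol⟩ := exists_angle_of_solOn (h := fun s => -h (d - s))
    (U := fun β s => V β (d - s)) (U' := fun β s => -V' β (d - s)) (U'' := fun β s => V'' β (d - s))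
    (a := fun β => -b β) hd₀ hq1 hlam
    (hhc.comp (by fun_prop) fun s hs => ⟨by linarith [hs.2, ht₀.1], by linarith [hs.1]⟩).neg
    (fun s hs => (neg_pos.2 (hneg (d - s) ⟨by linarith [hs.2], by linarith [hs.1]⟩)).le)
    (fun β => ⟨(hV β).1.reflect, by simp [(hV β).2.1], by simp [(hV β).2.2]⟩) hbCont.neg
    (by simp [hb1])
    (fun β hβ => by
      have he : enorm2 (V β t₀, -V' β t₀) = enorm2 (V β t₀, V' β t₀) := by simp [enorm2]
      simp only [sub_sub_cancel, he, Real.cos_neg, Real.sin_neg, mul_neg, neg_inj]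
      exact hbAngle β hβ) hβ.le
  have hcos : Real.cos (a α) = Real.cos (b β) := by
    rw [hab, show 2 * (k : ℝ) * Real.pi = k * (2 * Real.pi) by ring, Real.cos_sub_nat_mul_two_pi]
  have hsin : Real.sin (a α) = Real.sin (b β) := by
    rw [hab, show 2 * (k : ℝ) * Real.pi = k * (2 * Real.pi) by ring, Real.sin_sub_nat_mul_two_pi]
  have hUV : U α t₀ = V β t₀ := by
    rw [(haAngle α (by linarith)).1, (hbAngle β (by linarith)).1, hnorm, hcos]
  have hUV' : U' α t₀ = V' β t₀ := by
    rw [(haAngle α (by linarith)).2, (hbAngle β (by linarith)).2, hnorm, hsin]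
  have hsol := (hU α).1.glue ht₀ (hV β).1 hUV hUV'
  refine ⟨Prod.ext hUV hUV', hsol, ?_, ?_, ?_⟩
  · rw [if_pos ht₀.1.le, (hU α).2.2]
  · rw [if_neg ht₀.2.not_ge, (hV β).2.2]
  refine ncard_zeros_of_angle (u := fun t => if t ≤ t₀ then U α t else V β t)
    (u' := fun t => if t ≤ t₀ then U' α t else V' β t)
    (θ := fun t => if t ≤ t₀ then θ t else -φ (d - t) - 2 * k * Real.pi) hd
    (fun t ht => (hsol.1 t (Ioo_subset_Icc_self ht)).hasDerivAt (Icc_mem_nhds ht.1 ht.2))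
    (continuousOn_glue ?_ ?_ ?_) (fun t ht => ?_) ?_ ?_
  · exact hθ.mono fun t ht => ⟨ht.1.1, ht.2⟩
  · have : ContinuousOn (fun t => φ (d - t)) (Icc 0 d ∩ Ici t₀) :=
      hφ.comp (by fun_prop) fun t ht =>
        ⟨by linarith [ht.1.2], by linarith [show t₀ ≤ t from ht.2]⟩
    exact this.neg.sub continuousOn_const
  · rw [hθT, hφT, hab, neg_neg]
  · by_cases htc : t ≤ t₀
    · simpa only [if_pos htc] using hθpol t ⟨ht.1.le, htc⟩
    · obtain ⟨R, hR, h1, h2⟩ := hφpol (d - t)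
        ⟨by linarith [ht.2], by linarith [not_le.1 htc]⟩
      simp only [sub_sub_cancel] at h1 h2
      refine ⟨R, hR, ?_⟩
      simp only [if_neg htc]
      rw [show 2 * (k : ℝ) * Real.pi = k * (2 * Real.pi) by ring, Real.cos_sub_nat_mul_two_pi,
        Real.sin_sub_nat_mul_two_pi, Real.cos_neg, Real.sin_neg]
      exact ⟨h1, by linarith⟩
  · simp only [if_pos ht₀.1.le, hθ0]
  · simp only [if_neg ht₀.2.not_ge, sub_self, hφ0]
    ring
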